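/- (Meier's lemma, blow-up part.) Let c, α > 0 and suppose f(s) ≥ c s^{1+α} for all s ≥ 0. Let Φ be a bounded nonnegative classical solution of Φ_t = ΔΦ + u·∇Φ with initial datum Φ₀ ≥ 0, not identically zero, and set J := sup_{t > 0, x ∈ ℝ^N} t·Φ(t,x)^α ∈ (0,∞]. If δ₀ > 0 satisfies δ₀^{−α} < cαJ, then there is no classical solution T of T_t = ΔT + u·∇T + f(T) with initial datum T₀ = δ₀ Φ₀ defined for all t ∈ [0,∞); i.e., every such solution blows up in finite time. -/

import Mathlib

open MeasureTheory
open scoped BigOperators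

noncomputable section

/-- Partial derivative of `g : ℝ^N → ℝ` in the `i`-th coordinate direction. -/
def pd {N : ℕ} (i : Fin N) (g : (Fin N → ℝ) → ℝ) (z : Fin N → ℝ) : ℝ :=
  fderiv ℝ g z (Pi.single i 1)

/-- Laplacian of `g : ℝ^N → ℝ`. -/
def lap {N : ℕ} (g : (Fin N → ℝ) → ℝ) (z : Fin N → ℝ) : ℝ :=
  ∑ i, pd i (pd i g) z

/-- A classical solution of `T_t = ΔT + u·∇T + f(T)` on `ℝ^N`: continuous on
`[0,∞)×ℝ^N`, nonnegative, bounded on `[0,τ]×ℝ^N` for every `τ > 0`, `C¹` in `t` and `C²`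
in `x` for `t > 0`, satisfying the equation pointwise for `t > 0` and `T(0,·) = T₀`. -/
structure IsRDSol (N : ℕ) (u : (Fin N → ℝ) → Fin N → ℝ) (f : ℝ → ℝ)
    (T0 : (Fin N → ℝ) → ℝ) (T : ℝ → (Fin N → ℝ) → ℝ) : Prop where
  cont : ContinuousOn (fun p : ℝ × (Fin N → ℝ) => T p.1 p.2) {p | 0 ≤ p.1}
  nonneg : ∀ t z, 0 ≤ t → 0 ≤ T t z
  bddOnCompactTime : ∀ τ : ℝ, 0 < τ → ∃ C : ℝ, ∀ t z, 0 ≤ t → t ≤ τ → T t z ≤ C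
  timeDiff : ∀ t z, 0 < t → DifferentiableAt ℝ (fun s => T s z) t
  spaceC2 : ∀ t, 0 < t → ContDiff ℝ 2 (T t)
  eqn : ∀ t z, 0 < t →
    deriv (fun s => T s z) t
      = lap (T t) z + (∑ i, u z i * pd i (T t) z) + f (T t z)
  init : ∀ z, T 0 z = T0 z

/-- `T` quenches: `lim_{t→∞} sup_{x} T(t,x) = 0` (for nonnegative `T`). -/
def RDQuenches (N : ℕ) (T : ℝ → (Fin N → ℝ) → ℝ) : Prop :=
  ∀ ε > (0:ℝ), ∃ t₀ : ℝ, ∀ t ≥ t₀, ∀ z, T t z ≤ ε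

open Filter Topology

/-- The tangent line inequality for the convex function `x ↦ x ^ (-α)` at `z`. -/
lemma rpow_neg_tangent_le {α x z : ℝ} (hα : 0 < α) (hx : 0 < x) (hz : 0 < z) :
    z ^ (-α) * (1 + α - α * (x / z)) ≤ x ^ (-α) := by
  have hq : 0 < x / z := div_pos hx hz
  have h1 : 1 + α - α * (x / z) ≤ (x / z) ^ (-α) := by
    rw [Real.rpow_def_of_pos hq]
    have h2 := Real.add_one_le_exp (Real.log (x / z) * -α)
    have h3 := Real.log_le_sub_one_of_pos hq
    nlinarith
  calc z ^ (-α) * (1 + α - α * (x / z)) ≤ z ^ (-α) * (x / z) ^ (-α) := by gcongr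
    _ = x ^ (-α) := by
      rw [← Real.mul_rpow hz.le hq.le, mul_div_cancel₀ _ hz.ne']

/-- The flow of the differential equation with right-hand side `h ^ (1 + α) / α`, run backwards
for a time `k` from the value `y`: that is `(y ^ (-α) + k) ^ (-1 / α)`. -/
def backwardFlow (α k y : ℝ) : ℝ := (y ^ (-α) + k) ^ (-α)⁻¹

lemma backwardFlow_pos {α k y : ℝ} (hk : 0 ≤ k) (hy : 0 < y) : 0 < backwardFlow α k y := by
  unfold backwardFlow; positivity

lemma backwardFlow_rpow_neg {α k y : ℝ} (hα : 0 < α) (hk : 0 ≤ k) (hy : 0 < y) :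
    backwardFlow α k y ^ (-α) = y ^ (-α) + k := by
  unfold backwardFlow
  exact Real.rpow_inv_rpow (by positivity) (by linarith)

lemma backwardFlow_le_self {α k y : ℝ} (hα : 0 < α) (hk : 0 ≤ k) (hy : 0 < y) :
    backwardFlow α k y ≤ y := by
  rw [← Real.rpow_le_rpow_iff_of_neg hy (backwardFlow_pos hk hy) (neg_lt_zero.2 hα),
    backwardFlow_rpow_neg hα hk hy]
  linarith

lemma backwardFlow_zero {α y : ℝ} (hα : 0 < α) (hy : 0 < y) : backwardFlow α 0 y = y := by
  unfold backwardFlow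
  rw [add_zero, Real.rpow_rpow_inv hy.le (by linarith)]

lemma backwardFlow_le_rpow {α k y : ℝ} (hα : 0 < α) (hk : 0 < k) (hy : 0 < y) :
    backwardFlow α k y ≤ k ^ (-α)⁻¹ := by
  unfold backwardFlow
  have : 0 < y ^ (-α) := by positivity
  exact Real.rpow_le_rpow_of_nonpos hk (by linarith) (inv_nonpos.2 (by linarith))

/-- Concavity of `backwardFlow` in its last argument, as a tangent line bound. -/
lemma backwardFlow_le_tangent {α k y y₀ : ℝ} (hα : 0 < α) (hk : 0 ≤ k) (hy : 0 < y)
    (hy₀ : 0 < y₀) :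
    backwardFlow α k y ≤ backwardFlow α k y₀
      + (backwardFlow α k y₀ / y₀) ^ (1 + α) * (y - y₀) := by
  set h := backwardFlow α k y with hh
  set h₀ := backwardFlow α k y₀ with hh₀
  have hp : 0 < h := backwardFlow_pos hk hy
  have hp₀ : 0 < h₀ := backwardFlow_pos hk hy₀
  have e := backwardFlow_rpow_neg hα hk hy
  have e₀ := backwardFlow_rpow_neg hα hk hy₀
  rw [← hh] at e
  rw [← hh₀] at e₀
  set a := y₀ ^ (-α) with ha
  have hapos : 0 < a := by positivity
  have hbpos : 0 < h₀ ^ (-α) := by positivity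
  have hr : (h₀ / y₀) ^ (1 + α) = h₀ / y₀ * (a / h₀ ^ (-α)) := by
    rw [Real.rpow_add (by positivity), Real.rpow_one, Real.div_rpow hp₀.le hy₀.le, ha,
      Real.rpow_neg hp₀.le, Real.rpow_neg hy₀.le]
    field_simp
  rw [hr, e₀]
  have hak : 0 < a + k := by positivity
  set m := h₀ * (k + a * (y / y₀)) / (a + k) with hm
  have hmpos : 0 < m := by positivity
  have hgoal : h₀ + h₀ / y₀ * (a / (a + k)) * (y - y₀) = m := by
    rw [hm]; field_simp; ring
  rw [hgoal, ← Real.rpow_le_rpow_iff_of_neg hmpos hp (neg_lt_zero.2 hα), e]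
  have hr0 : 0 < m / h₀ := by positivity
  have t1 := rpow_neg_tangent_le hα hy (mul_pos hr0 hy₀)
  have t2 := rpow_neg_tangent_le hα one_pos hr0
  rw [Real.mul_rpow hr0.le hy₀.le, ← ha] at t1
  rw [Real.one_rpow] at t2
  have t3 := mul_le_mul_of_nonneg_left t2 hk
  have hfac : m ^ (-α) = (m / h₀) ^ (-α) * (a + k) := by
    rw [← e₀, ← Real.mul_rpow hr0.le hp₀.le, div_mul_cancel₀ _ hp₀.ne']
  have hsum : (m / h₀) ^ (-α) * a * (1 + α - α * (y / (m / h₀ * y₀)))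
      + k * ((m / h₀) ^ (-α) * (1 + α - α * (1 / (m / h₀)))) = (m / h₀) ^ (-α) * (a + k) := by
    have : a * (y / (m / h₀ * y₀)) + k * (1 / (m / h₀)) = a + k := by
      have hm' : m / h₀ = (k + a * (y / y₀)) / (a + k) := by rw [hm]; field_simp
      have : 0 < k + a * (y / y₀) := by positivity
      rw [hm']; field_simp; ring
    linear_combination (-(m / h₀) ^ (-α) * α) * this
  linarith

lemma hasDerivAt_backwardFlow {α m d t₀ : ℝ} {y : ℝ → ℝ} (hα : 0 < α) (hm : 0 ≤ m)
    (ht₀ : 0 ≤ t₀) (hy : HasDerivAt y d t₀) (hpos : 0 < y t₀) :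
    HasDerivAt (fun t => backwardFlow α (m * t) (y t))
      (-(m / α) * backwardFlow α (m * t₀) (y t₀) ^ (1 + α)
        + (backwardFlow α (m * t₀) (y t₀) / y t₀) ^ (1 + α) * d) t₀ := by
  have hk : 0 ≤ m * t₀ := mul_nonneg hm ht₀
  have hB : 0 < y t₀ ^ (-α) + m * t₀ := by positivity
  have h1 := ((hy.rpow_const (p := -α) (Or.inl hpos.ne')).add
    ((hasDerivAt_id t₀).const_mul m)).rpow_const (p := (-α)⁻¹) (Or.inl hB.ne')
  refine h1.congr_deriv ?_
  have hh := backwardFlow_pos (α := α) hk hpos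
  have e : (y t₀ ^ (-α) + m * t₀) ^ ((-α)⁻¹ - 1) = backwardFlow α (m * t₀) (y t₀) ^ (1 + α) := by
    unfold backwardFlow
    rw [← Real.rpow_mul hB.le]
    congr 1
    field_simp
    ring
  have e2 : y t₀ ^ (-α - 1) = (y t₀ ^ (1 + α))⁻¹ := by
    rw [← Real.rpow_neg hpos.le]; congr 1; ring
  simp only [Pi.add_apply, id]
  rw [e, e2, Real.div_rpow hh.le hpos.le]
  field_simp
  ring

/-- A left-sided maximum has nonnegative derivative. -/
lemma HasDerivAt.nonneg_of_left_max {φ : ℝ → ℝ} {d a t₀ : ℝ} (h : HasDerivAt φ d t₀) (ha : a < t₀)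
    (hmax : ∀ s, a < s → s < t₀ → φ s ≤ φ t₀) : 0 ≤ d := by
  have h1 := (hasDerivWithinAt_iff_tendsto_slope' (s := Set.Iio t₀) (by simp)).1
    h.hasDerivWithinAt
  refine ge_of_tendsto h1 ?_
  filter_upwards [Ioo_mem_nhdsLT ha] with s hs
  rw [slope_def_field]
  exact div_nonneg_of_nonpos (by linarith [hmax s hs.1 hs.2]) (by linarith [hs.2])

lemma IsLocalMax.deriv_deriv_nonpos {φ : ℝ → ℝ} {x : ℝ} (h : IsLocalMax φ x)
    (hc : ContinuousAt φ x) : deriv (deriv φ) x ≤ 0 := by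
  by_contra! hpos
  have hmin := isLocalMin_of_deriv_deriv_pos hpos h.deriv_eq_zero hc
  have heq : φ =ᶠ[𝓝 x] fun _ => φ x := by
    filter_upwards [h, hmin] with s h1 h2 using le_antisymm h1 h2
  have := heq.deriv.deriv_eq
  simp at this
  exact hpos.ne' this

section PartialDerivatives

variable {N : ℕ}

lemma hasDerivAt_comp_line {g : (Fin N → ℝ) → ℝ} (hg : Differentiable ℝ g) (i : Fin N)
    (z : Fin N → ℝ) (s : ℝ) :
    HasDerivAt (fun s : ℝ => g (z + s • Pi.single i 1)) (pd i g (z + s • Pi.single i 1)) s := by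
  have h : HasDerivAt (fun s : ℝ => z + s • (Pi.single i 1 : Fin N → ℝ)) (Pi.single i 1) s := by
    simpa using ((hasDerivAt_id s).smul_const (Pi.single i (1 : ℝ) : Fin N → ℝ)).const_add z
  exact (hg _).hasFDerivAt.comp_hasDerivAt s h

lemma ContDiff.differentiable_pd {g : (Fin N → ℝ) → ℝ} (hg : ContDiff ℝ 2 g) (i : Fin N) :
    Differentiable ℝ (pd i g) := by
  have : ContDiff ℝ 1 (pd i g) := (hg.fderiv_right (m := 1) (by norm_num)).clm_apply contDiff_const
  exact this.differentiable (by norm_num)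

lemma pd_eq_zero_of_isMax {g : (Fin N → ℝ) → ℝ} {z : Fin N → ℝ}
    (hmax : ∀ x, g x ≤ g z) (i : Fin N) : pd i g z = 0 := by
  have : IsLocalMax g z := Filter.Eventually.of_forall hmax
  simp [pd, this.fderiv_eq_zero]

lemma pd_pd_nonpos_of_isMax {g : (Fin N → ℝ) → ℝ} (hg : ContDiff ℝ 2 g) {z : Fin N → ℝ}
    (hmax : ∀ x, g x ≤ g z) (i : Fin N) : pd i (pd i g) z ≤ 0 := by
  have hd := hg.differentiable (by norm_num)
  have h1 : deriv (fun s : ℝ => g (z + s • Pi.single i 1))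
      = fun s : ℝ => pd i g (z + s • Pi.single i 1) :=
    funext fun s => (hasDerivAt_comp_line hd i z s).deriv
  have h2 := (hasDerivAt_comp_line (hg.differentiable_pd i) i z 0).deriv
  have hloc : IsLocalMax (fun s : ℝ => g (z + s • Pi.single i 1)) 0 :=
    Filter.Eventually.of_forall fun s => by simpa using hmax _
  have h3 := hloc.deriv_deriv_nonpos (hasDerivAt_comp_line hd i z 0).continuousAt
  rw [h1, h2] at h3
  simpa using h3

lemma lap_nonpos_of_isMax {g : (Fin N → ℝ) → ℝ} (hg : ContDiff ℝ 2 g) {z : Fin N → ℝ}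
    (hmax : ∀ x, g x ≤ g z) : lap g z ≤ 0 :=
  Finset.sum_nonpos fun i _ => pd_pd_nonpos_of_isMax hg hmax i

lemma pd_linear_comb {F G Q : (Fin N → ℝ) → ℝ} (hF : Differentiable ℝ F)
    (hG : Differentiable ℝ G) (hQ : Differentiable ℝ Q) (a b e : ℝ) (i : Fin N) :
    pd i (fun z => a * F z - b * G z - e * Q z)
      = fun z => a * pd i F z - b * pd i G z - e * pd i Q z := by
  funext z
  have h := (((hF z).hasFDerivAt.const_mul a).sub ((hG z).hasFDerivAt.const_mul b)).sub
    ((hQ z).hasFDerivAt.const_mul e)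
  have h' : fderiv ℝ (fun z => a * F z - b * G z - e * Q z) z = _ := h.fderiv
  simp [pd, h']

lemma lap_linear_comb {F G Q : (Fin N → ℝ) → ℝ} (hF : ContDiff ℝ 2 F)
    (hG : ContDiff ℝ 2 G) (hQ : ContDiff ℝ 2 Q) (a b e : ℝ) (z : Fin N → ℝ) :
    lap (fun z => a * F z - b * G z - e * Q z) z = a * lap F z - b * lap G z - e * lap Q z := by
  unfold lap
  rw [Finset.mul_sum, Finset.mul_sum, Finset.mul_sum, ← Finset.sum_sub_distrib,
    ← Finset.sum_sub_distrib]
  refine Finset.sum_congr rfl fun i _ => ?_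
  rw [pd_linear_comb (hF.differentiable (by norm_num)) (hG.differentiable (by norm_num))
    (hQ.differentiable (by norm_num)), pd_linear_comb (hF.differentiable_pd i)
    (hG.differentiable_pd i) (hQ.differentiable_pd i)]

/-- The quadratic weight `1 + |z|²`. -/
def quadWeight (z : Fin N → ℝ) : ℝ := 1 + ∑ j, z j ^ 2

lemma one_le_quadWeight (z : Fin N → ℝ) : 1 ≤ quadWeight z := by
  have : 0 ≤ ∑ j, z j ^ 2 := Finset.sum_nonneg fun j _ => sq_nonneg _
  unfold quadWeight; linarith

lemma contDiff_quadWeight : ContDiff ℝ 2 (quadWeight (N := N)) := by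
  unfold quadWeight; fun_prop

lemma pd_quadWeight (i : Fin N) : pd i (quadWeight (N := N)) = fun z => 2 * z i := by
  funext z
  have h : HasFDerivAt (quadWeight (N := N))
      (∑ j, (2 * z j) • (ContinuousLinearMap.proj j : (Fin N → ℝ) →L[ℝ] ℝ)) z := by
    refine (HasFDerivAt.fun_sum fun j _ => ?_).const_add 1
    have hj : HasFDerivAt (fun z : Fin N → ℝ => z j)
        (ContinuousLinearMap.proj j : (Fin N → ℝ) →L[ℝ] ℝ) z := hasFDerivAt_apply j z
    simpa using hj.pow 2
  simp [pd, h.fderiv, Pi.single_apply]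

lemma lap_quadWeight (z : Fin N → ℝ) : lap quadWeight z = 2 * N := by
  have h (i : Fin N) : pd i (fun z : Fin N → ℝ => 2 * z i) z = 2 := by
    simp [pd, ((hasFDerivAt_apply (𝕜 := ℝ) i z).const_mul 2).fderiv]
  simp only [lap, pd_quadWeight, h]
  simp [mul_comm]

/-- The drift-diffusion operator applied to `quadWeight` is controlled by `quadWeight`. -/
lemma lap_add_drift_quadWeight_le {C : ℝ} {v : Fin N → ℝ} (hv : ‖v‖ ≤ C) (z : Fin N → ℝ) :
    lap quadWeight z + ∑ i, v i * pd i quadWeight z ≤ (2 * N + C * N + C) * quadWeight z := by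
  have hC : 0 ≤ C := (norm_nonneg v).trans hv
  have h1 : ∑ i, v i * pd i quadWeight z ≤ ∑ i, C * (1 + z i ^ 2) := by
    refine Finset.sum_le_sum fun i _ => ?_
    rw [pd_quadWeight]
    have h := abs_le.1 ((norm_le_pi_norm v i).trans hv)
    have h0 := abs_nonneg (z i)
    have : v i * (2 * z i) ≤ C * (2 * |z i|) := by
      calc v i * (2 * z i) ≤ |v i * (2 * z i)| := le_abs_self _
        _ = |v i| * (2 * |z i|) := by rw [abs_mul, abs_mul, abs_two]
        _ ≤ C * (2 * |z i|) := by gcongr; exact abs_le.2 h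
    nlinarith [sq_nonneg (1 - |z i|), sq_abs (z i)]
  rw [← Finset.mul_sum, Finset.sum_add_distrib] at h1
  rw [lap_quadWeight]
  have hs : 0 ≤ ∑ j, z j ^ 2 := Finset.sum_nonneg fun j _ => sq_nonneg _
  have hN : (0 : ℝ) ≤ N := Nat.cast_nonneg N
  simp only [Finset.sum_const, Finset.card_univ, Fintype.card_fin, nsmul_eq_mul, mul_one] at h1
  refine (add_le_add_right h1 _).trans ?_
  unfold quadWeight
  nlinarith [mul_nonneg hN hs, mul_nonneg (mul_nonneg hC hN) hs]

lemma sq_norm_le_quadWeight (z : Fin N → ℝ) : ‖z‖ ^ 2 ≤ quadWeight z := by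
  have hs : 0 ≤ ∑ j, z j ^ 2 := Finset.sum_nonneg fun j _ => sq_nonneg _
  have : ‖z‖ ≤ Real.sqrt (∑ j, z j ^ 2) := by
    refine (pi_norm_le_iff_of_nonneg (Real.sqrt_nonneg _)).2 fun i => ?_
    refine Real.abs_le_sqrt ?_
    exact Finset.single_le_sum (f := fun j => z j ^ 2) (fun j _ => sq_nonneg _) (Finset.mem_univ i)
  have h2 := (Real.le_sqrt (norm_nonneg _) hs).1 this
  unfold quadWeight; linarith

end PartialDerivatives

/-- Bernoulli's inequality in the form used for the shifted reaction term. -/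
lemma rpow_one_add_sub_le {α ε s : ℝ} (hα : 0 < α) (hε : 0 < ε) (hs : 0 ≤ s) :
    (s + ε) ^ (1 + α) - (1 + α) * ε * (s + ε) ^ α ≤ s ^ (1 + α) := by
  have hy : 0 < s + ε := by linarith
  have hle : -1 ≤ -(ε / (s + ε)) := by
    rw [neg_le_neg_iff, div_le_one hy]; linarith
  have h := one_add_mul_self_le_rpow_one_add hle (p := 1 + α) (by linarith)
  have hq : 1 + -(ε / (s + ε)) = s / (s + ε) := by field_simp; ring
  rw [hq, Real.div_rpow hs hy.le, le_div_iff₀ (by positivity)] at h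
  refine le_trans (le_of_eq ?_) h
  rw [Real.rpow_add hy, Real.rpow_one]
  field_simp
  ring

section Comparison

variable {N : ℕ} {u : (Fin N → ℝ) → Fin N → ℝ} {f : ℝ → ℝ} {c α δ : ℝ}
  {Φ0 : (Fin N → ℝ) → ℝ} {Φ T : ℝ → (Fin N → ℝ) → ℝ}

/-- At a positive time, the difference between the multiple of a linear solution and the
penalized backward flow of a reaction-diffusion solution has no maximum over the past. -/
lemma not_isMax_penalized_difference (hc : 0 < c) (hα : 0 < α)
    (hf_ge : ∀ s : ℝ, 0 ≤ s → c * s ^ (1 + α) ≤ f s) {T0 : (Fin N → ℝ) → ℝ}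
    (hΦ : IsRDSol N u (fun _ => 0) Φ0 Φ) (hT : IsRDSol N u f T0 T)
    {Cu C : ℝ} (hu : ∀ z, ‖u z‖ ≤ Cu) {ε A t₀ : ℝ} (hε : 0 < ε) (hε1 : ε ≤ 1) (ht₀ : 0 < t₀)
    {z₀ : Fin N → ℝ} (hC : T t₀ z₀ ≤ C)
    (hA : 2 * N + Cu * N + Cu + c * (1 + α) * (C + 1) ^ α < A)
    (hmax : ∀ t z, 0 ≤ t → t ≤ t₀ →
      δ * Φ t z - backwardFlow α (c * α * t) (T t z + ε) - ε * (Real.exp (A * t) * quadWeight z)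
      ≤ δ * Φ t₀ z₀ - backwardFlow α (c * α * t₀) (T t₀ z₀ + ε)
        - ε * (Real.exp (A * t₀) * quadWeight z₀)) : False := by
  have hm : 0 < c * α := mul_pos hc hα
  have hpos : ∀ z, 0 < T t₀ z + ε := fun z => by linarith [hT.nonneg t₀ z ht₀.le]
  have hk : 0 ≤ c * α * t₀ := by positivity
  set y := T t₀ z₀ + ε with hy
  set h := backwardFlow α (c * α * t₀) y with hh
  have hhpos : 0 < h := backwardFlow_pos hk (hpos z₀)
  have hypos : 0 < y := hpos z₀
  set b := (h / y) ^ (1 + α) with hb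
  have hbpos : 0 < b := by positivity
  have hb1 : b ≤ 1 := Real.rpow_le_one (by positivity)
    ((div_le_one hypos).2 (backwardFlow_le_self hα hk hypos)) (by linarith)
  set e := ε * Real.exp (A * t₀) with he
  have hgmax : ∀ x, δ * Φ t₀ x - b * T t₀ x - e * quadWeight x
      ≤ δ * Φ t₀ z₀ - b * T t₀ z₀ - e * quadWeight z₀ := by
    intro x
    have h1 := hmax t₀ x ht₀.le le_rfl
    have h2 := backwardFlow_le_tangent hα hk (hpos x) hypos
    rw [← hh, ← hb] at h2
    have h3 : b * (T t₀ x + ε - y) = b * T t₀ x - b * T t₀ z₀ := by rw [hy]; ring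
    rw [he]
    linarith
  have hΦc := hΦ.spaceC2 t₀ ht₀
  have hTc := hT.spaceC2 t₀ ht₀
  have hgc : ContDiff ℝ 2 (fun x => δ * Φ t₀ x - b * T t₀ x - e * quadWeight x) :=
    ((contDiff_const.mul hΦc).sub (contDiff_const.mul hTc)).sub
      (contDiff_const.mul contDiff_quadWeight)
  have hlap := lap_nonpos_of_isMax hgc hgmax
  rw [lap_linear_comb hΦc hTc contDiff_quadWeight] at hlap
  have hgrad : δ * (∑ i, u z₀ i * pd i (Φ t₀) z₀) - b * (∑ i, u z₀ i * pd i (T t₀) z₀)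
      - e * (∑ i, u z₀ i * pd i quadWeight z₀) = 0 := by
    rw [Finset.mul_sum, Finset.mul_sum, Finset.mul_sum, ← Finset.sum_sub_distrib,
      ← Finset.sum_sub_distrib]
    refine Finset.sum_eq_zero fun i _ => ?_
    have h1 := pd_eq_zero_of_isMax hgmax i
    rw [pd_linear_comb (hΦc.differentiable (by norm_num)) (hTc.differentiable (by norm_num))
      (contDiff_quadWeight.differentiable (by norm_num))] at h1
    linear_combination u z₀ i * h1
  have hyd : HasDerivAt (fun t => T t z₀ + ε) (deriv (fun s => T s z₀) t₀) t₀ :=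
    (hT.timeDiff t₀ z₀ ht₀).hasDerivAt.add_const ε
  have hbd := hasDerivAt_backwardFlow hα hm.le ht₀.le hyd hypos
  have hexp : HasDerivAt (fun t => ε * (Real.exp (A * t) * quadWeight z₀))
      (A * e * quadWeight z₀) t₀ := by
    have h1 := ((((hasDerivAt_id t₀).const_mul A).exp).mul_const (quadWeight z₀)).const_mul ε
    refine h1.congr_deriv ?_
    simp only [id, he]; ring
  have htime := (((hΦ.timeDiff t₀ z₀ ht₀).hasDerivAt.const_mul δ).sub hbd).sub hexp
  have hnn := htime.nonneg_of_left_max ht₀ fun s hs0 hs => hmax s z₀ hs0.le hs.le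
  simp only [← hy, ← hh, ← hb] at hnn
  rw [hΦ.eqn t₀ z₀ ht₀, hT.eqn t₀ z₀ ht₀, mul_div_cancel_right₀ _ hα.ne'] at hnn
  have hreact : c * h ^ (1 + α) - ε * (c * (1 + α) * (C + 1) ^ α) ≤ b * f (T t₀ z₀) := by
    have h1 := hf_ge _ (hT.nonneg t₀ z₀ ht₀.le)
    have h2 := rpow_one_add_sub_le hα hε (hT.nonneg t₀ z₀ ht₀.le)
    rw [← hy] at h2
    have h3 : b * y ^ (1 + α) = h ^ (1 + α) := by
      rw [hb, ← Real.mul_rpow (by positivity) hypos.le, div_mul_cancel₀ _ hypos.ne']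
    have h4 : b * y ^ α ≤ (C + 1) ^ α := by
      calc b * y ^ α ≤ 1 * y ^ α := by gcongr
        _ = y ^ α := one_mul _
        _ ≤ (C + 1) ^ α := Real.rpow_le_rpow hypos.le (by linarith) hα.le
    calc c * h ^ (1 + α) - ε * (c * (1 + α) * (C + 1) ^ α)
        ≤ c * h ^ (1 + α) - ε * (c * (1 + α) * (b * y ^ α)) := by gcongr
      _ = b * (c * (y ^ (1 + α) - (1 + α) * ε * y ^ α)) := by rw [← h3]; ring
      _ ≤ b * (c * T t₀ z₀ ^ (1 + α)) := by gcongr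
      _ ≤ b * f (T t₀ z₀) := by gcongr
  have hQ := lap_add_drift_quadWeight_le (hu z₀) z₀
  have hQ1 := one_le_quadWeight z₀
  have hCu : 0 ≤ Cu := (norm_nonneg _).trans (hu z₀)
  have hC0 : 0 ≤ C := (hT.nonneg t₀ z₀ ht₀.le).trans hC
  have hK : 0 ≤ c * (1 + α) * (C + 1) ^ α := by positivity
  have hA0 : 0 ≤ A := by
    have : (0 : ℝ) ≤ N := Nat.cast_nonneg N
    have : 0 ≤ Cu * N := by positivity
    linarith
  have heε : ε ≤ e := by
    rw [he]
    exact le_mul_of_one_le_right hε.le (Real.one_le_exp (by positivity))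
  have he0 : 0 < e := hε.trans_le heε
  have h5 := mul_le_mul_of_nonneg_left hQ he0.le
  have h6 : ε * (c * (1 + α) * (C + 1) ^ α) ≤ e * (c * (1 + α) * (C + 1) ^ α) * quadWeight z₀ :=
    (mul_le_mul_of_nonneg_right heε hK).trans
      (le_mul_of_one_le_right (mul_nonneg he0.le hK) hQ1)
  have h7 : e * quadWeight z₀ * (2 * N + Cu * N + Cu + c * (1 + α) * (C + 1) ^ α)
      < e * quadWeight z₀ * A := mul_lt_mul_of_pos_left hA (by positivity)
  linarith

/-- Comparison between a multiple of a linear solution and the backward flow of a solution of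
the reaction-diffusion equation, up to a penalization. -/
lemma exists_penalized_comparison (hu_bdd : ∃ C : ℝ, ∀ z, ‖u z‖ ≤ C) (hc : 0 < c) (hα : 0 < α)
    (hf_ge : ∀ s : ℝ, 0 ≤ s → c * s ^ (1 + α) ≤ f s)
    (hΦ : IsRDSol N u (fun _ => 0) Φ0 Φ) (hδ : 0 < δ)
    (hT : IsRDSol N u f (fun z => δ * Φ0 z) T) {τ : ℝ} (hτ : 0 < τ) :
    ∃ A : ℝ, ∀ ε, 0 < ε → ε ≤ 1 → ∀ t z, 0 ≤ t → t ≤ τ →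
      δ * Φ t z ≤ backwardFlow α (c * α * t) (T t z + ε)
        + ε * (Real.exp (A * t) * quadWeight z) := by
  obtain ⟨Cu, hu⟩ := hu_bdd
  obtain ⟨M, hM⟩ := hΦ.bddOnCompactTime τ hτ
  obtain ⟨C, hC⟩ := hT.bddOnCompactTime τ hτ
  have hM0 : 0 ≤ M := (hΦ.nonneg 0 0 le_rfl).trans (hM 0 0 le_rfl hτ.le)
  have hC0 : 0 ≤ C := (hT.nonneg 0 0 le_rfl).trans (hC 0 0 le_rfl hτ.le)
  have hCu : 0 ≤ Cu := (norm_nonneg _).trans (hu 0)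
  refine ⟨2 * N + Cu * N + Cu + c * (1 + α) * (C + 1) ^ α + 1, fun ε hε hε1 => ?_⟩
  set A := 2 * N + Cu * N + Cu + c * (1 + α) * (C + 1) ^ α + 1 with hA
  have hA0 : 0 ≤ A := by positivity
  by_contra! hcon
  obtain ⟨t₁, z₁, ht₁, ht₁τ, hlt⟩ := hcon
  set W : ℝ × (Fin N → ℝ) → ℝ := fun p => δ * Φ p.1 p.2
    - backwardFlow α (c * α * p.1) (T p.1 p.2 + ε) - ε * (Real.exp (A * p.1) * quadWeight p.2)
    with hW
  have hW₁ : 0 < W (t₁, z₁) := by simp only [hW]; linarith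
  have hypos : ∀ t z, 0 ≤ t → 0 < T t z + ε := fun t z ht => by linarith [hT.nonneg t z ht]
  have hkpos : ∀ t, 0 ≤ t → 0 ≤ c * α * t := fun t ht => by positivity
  set R := max ‖z₁‖ (max 1 (δ * M / ε)) with hR
  have hcont : ContinuousOn W (Set.Icc 0 τ ×ˢ Metric.closedBall 0 R) := by
    have hsub : Set.Icc 0 τ ×ˢ Metric.closedBall (0 : Fin N → ℝ) R ⊆ {p | 0 ≤ p.1} :=
      fun p hp => hp.1.1
    have hQ : Continuous (quadWeight (N := N)) := contDiff_quadWeight.continuous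
    have hTε : ContinuousOn (fun p : ℝ × (Fin N → ℝ) => T p.1 p.2 + ε)
        (Set.Icc 0 τ ×ˢ Metric.closedBall 0 R) := (hT.cont.mono hsub).add continuousOn_const
    have hbase : ContinuousOn (fun p : ℝ × (Fin N → ℝ) => (T p.1 p.2 + ε) ^ (-α) + c * α * p.1)
        (Set.Icc 0 τ ×ˢ Metric.closedBall 0 R) :=
      (hTε.rpow_const fun p hp => Or.inl (hypos _ _ hp.1.1).ne').add (by fun_prop)
    have hflow : ContinuousOn (fun p : ℝ × (Fin N → ℝ) =>
        backwardFlow α (c * α * p.1) (T p.1 p.2 + ε)) (Set.Icc 0 τ ×ˢ Metric.closedBall 0 R) := by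
      refine hbase.rpow_const fun p hp => Or.inl ?_
      have h1 := hypos p.1 p.2 hp.1.1
      have h2 := hkpos p.1 hp.1.1
      positivity
    exact ((continuousOn_const.mul (hΦ.cont.mono hsub)).sub hflow).sub (by fun_prop)
  have hmem : (t₁, z₁) ∈ Set.Icc 0 τ ×ˢ Metric.closedBall (0 : Fin N → ℝ) R :=
    ⟨⟨ht₁, ht₁τ⟩, by simp [hR]⟩
  obtain ⟨⟨t₀, z₀⟩, hmem₀, hmax⟩ :=
    (isCompact_Icc.prod (isCompact_closedBall (0 : Fin N → ℝ) R)).exists_isMaxOn ⟨_, hmem⟩ hcont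
  have hW₀ : 0 < W (t₀, z₀) := hW₁.trans_le (hmax hmem)
  have hglobal : ∀ t z, 0 ≤ t → t ≤ τ → W (t, z) ≤ W (t₀, z₀) := by
    intro t z ht htτ
    by_cases hz : ‖z‖ ≤ R
    · exact hmax (show (t, z) ∈ _ from ⟨⟨ht, htτ⟩, by simpa using hz⟩)
    · refine le_trans ?_ hW₀.le
      have hR1 : 1 ≤ R := (le_max_left _ _).trans (le_max_right _ _)
      have hR2 : δ * M / ε ≤ R := (le_max_right _ _).trans (le_max_right _ _)
      have h1 : R ≤ quadWeight z := by
        have := sq_norm_le_quadWeight z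
        nlinarith
      have h2 : quadWeight z ≤ Real.exp (A * t) * quadWeight z :=
        le_mul_of_one_le_left (by linarith) (Real.one_le_exp (by positivity))
      have h3 : δ * M ≤ ε * (Real.exp (A * t) * quadWeight z) := by
        rw [div_le_iff₀ hε] at hR2
        nlinarith
      have h4 : δ * Φ t z ≤ δ * M := by gcongr; exact hM t z ht htτ
      have h5 := backwardFlow_pos (α := α) (hkpos t ht) (hypos t z ht)
      simp only [hW]
      linarith
  have ht₀ : 0 < t₀ := by
    refine lt_of_le_of_ne hmem₀.1.1 fun h0 => ?_
    have h1 := hypos 0 z₀ le_rfl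
    have h2 := one_le_quadWeight z₀
    have h3 : 0 < ε * (Real.exp (A * 0) * quadWeight z₀) := by positivity
    rw [hT.init] at h1
    simp only [hW, ← h0, mul_zero, hT.init, hΦ.init] at hW₀
    rw [backwardFlow_zero hα h1] at hW₀
    simp only [mul_zero] at h3
    linarith
  exact not_isMax_penalized_difference hc hα hf_ge hΦ hT hu hε hε1 ht₀
    (hC t₀ z₀ ht₀.le hmem₀.1.2) (by linarith)
    fun t z ht htt => hglobal t z ht (htt.trans hmem₀.1.2)

/-- Universal upper bound for linear solutions lying initially below a global solution of the
reaction-diffusion equation. -/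
lemma linear_solution_le_of_global_solution (hu_bdd : ∃ C : ℝ, ∀ z, ‖u z‖ ≤ C) (hc : 0 < c)
    (hα : 0 < α) (hf_ge : ∀ s : ℝ, 0 ≤ s → c * s ^ (1 + α) ≤ f s)
    (hΦ : IsRDSol N u (fun _ => 0) Φ0 Φ) (hδ : 0 < δ)
    (hT : IsRDSol N u f (fun z => δ * Φ0 z) T) {τ : ℝ} (hτ : 0 < τ) (z : Fin N → ℝ) :
    δ * Φ τ z ≤ (c * α * τ) ^ (-α)⁻¹ := by
  obtain ⟨A, hA⟩ := exists_penalized_comparison hu_bdd hc hα hf_ge hΦ hδ hT hτ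
  have hlim : Tendsto (fun ε : ℝ => (c * α * τ) ^ (-α)⁻¹ + ε * (Real.exp (A * τ) * quadWeight z))
      (𝓝[>] 0) (𝓝 ((c * α * τ) ^ (-α)⁻¹)) := by
    refine Tendsto.mono_left ?_ nhdsWithin_le_nhds
    have : Continuous fun ε : ℝ =>
      (c * α * τ) ^ (-α)⁻¹ + ε * (Real.exp (A * τ) * quadWeight z) := by fun_prop
    simpa using this.tendsto 0
  refine ge_of_tendsto hlim ?_
  filter_upwards [Ioo_mem_nhdsGT one_pos] with ε hε
  refine (hA ε hε.1 hε.2.le τ z hτ.le le_rfl).trans ?_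
  have h1 : 0 < T τ z + ε := by linarith [hT.nonneg τ z hτ.le, hε.1]
  gcongr
  exact backwardFlow_le_rpow hα (by positivity) h1

end Comparison

/-- Meier's lemma, blow-up part. Suppose `f(s) ≥ c s^{1+α}` for `s ≥ 0`,
`Φ` is a bounded nonnegative classical solution of the linear equation with `Φ₀ ≥ 0`,
`Φ₀ ≢ 0`, and `δ₀ > 0` satisfies `δ₀^{-α} < cαJ` where `J = sup_{t>0,x} t Φ(t,x)^α`
(expressed below by the existence of `t > 0` and `x` with `δ₀^{-α} < cα t Φ(t,x)^α`).
Then there is no globally defined classical solution of `T_t = ΔT + u·∇T + f(T)` with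
initial datum `δ₀ Φ₀`: every such solution blows up in finite time. -/
theorem quenching_paper_stmt7
    (N : ℕ) (hN : 1 ≤ N)
    (u : (Fin N → ℝ) → Fin N → ℝ) (hu_cont : Continuous u)
    (hu_bdd : ∃ C : ℝ, ∀ z, ‖u z‖ ≤ C)
    (f : ℝ → ℝ) (hf0 : f 0 = 0)
    (hf_nonneg : ∀ s : ℝ, 0 ≤ s → 0 ≤ f s)
    (hf_locLip : ∀ R : ℝ, 0 < R → ∃ K, LipschitzOnWith K f (Set.Icc 0 R))
    (c α : ℝ) (hc : 0 < c) (hα : 0 < α)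
    (hf_ge : ∀ s : ℝ, 0 ≤ s → c * s ^ (1 + α) ≤ f s)
    (Φ0 : (Fin N → ℝ) → ℝ) (hΦ0 : ∀ z, 0 ≤ Φ0 z) (hΦ0_ne : ∃ z, Φ0 z ≠ 0)
    (Φ : ℝ → (Fin N → ℝ) → ℝ)
    (hΦ : IsRDSol N u (fun _ => 0) Φ0 Φ)
    (hΦ_bdd : ∃ C : ℝ, ∀ t z, 0 ≤ t → Φ t z ≤ C)
    (δ₀ : ℝ) (hδ₀ : 0 < δ₀)
    (hδ : ∃ t : ℝ, 0 < t ∧ ∃ z, δ₀ ^ (-α) < c * α * (t * (Φ t z) ^ α)) :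
    ∀ T : ℝ → (Fin N → ℝ) → ℝ, ¬ IsRDSol N u f (fun z => δ₀ * Φ0 z) T := by
  intro T hT
  obtain ⟨t, ht, z, hlt⟩ := hδ
  have hle := linear_solution_le_of_global_solution hu_bdd hc hα hf_ge hΦ hδ₀ hT ht z
  have hΦpos : 0 < Φ t z := by
    refine lt_of_le_of_ne (hΦ.nonneg t z ht.le) fun h0 => ?_
    rw [← h0, Real.zero_rpow hα.ne', mul_zero, mul_zero] at hlt
    exact (Real.rpow_pos_of_pos hδ₀ _).not_gt hlt
  rw [Real.le_rpow_inv_iff_of_neg (by positivity) (by positivity) (neg_lt_zero.2 hα),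
    Real.mul_rpow hδ₀.le hΦpos.le, Real.rpow_neg hΦpos.le, ← div_eq_mul_inv,
    le_div_iff₀ (by positivity)] at hle
  linarith
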